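/- Let E be a real inner product space, let λ, L > 0, and let F : E → ℝ be differentiable, λ-strongly convex, with L-Lipschitz gradient, and suppose ∇F(w*) = 0 for some w* ∈ E. Then for every w ∈ E and every η with 0 ≤ η ≤ 2/(λ + L): ‖w − η·∇F(w) − w*‖ ≤ (1 − ηλL/(λ + L))·‖w − w*‖. -/

import Mathlib

open scoped RealInnerProductSpace

lemma aux_descent {E : Type*} [NormedAddCommGroup E] [InnerProductSpace ℝ E]
    (F : E → ℝ) (F' : E → E) (L : ℝ)
    (hdiff : ∀ x : E, HasFDerivAt F (InnerProductSpace.toDualMap ℝ E (F' x) : E →L[ℝ] ℝ) x)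
    (hlip : ∀ u v : E, ‖F' u - F' v‖ ≤ L * ‖u - v‖) (v h : E) :
    F (v + h) ≤ F v + ⟪F' v, h⟫ + L / 2 * ‖h‖ ^ 2 := by
  have hd : ∀ t : ℝ, HasDerivAt
      (fun t : ℝ => F (v + t • h) - t * ⟪F' v, h⟫ - L / 2 * ‖h‖ ^ 2 * t ^ 2)
      (⟪F' (v + t • h), h⟫ - ⟪F' v, h⟫ - L * ‖h‖ ^ 2 * t) t := by
    intro t
    have h1 : HasDerivAt (fun t : ℝ => v + t • h) h t := by
      simpa using ((hasDerivAt_id t).smul_const h).const_add v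
    have h2 : HasDerivAt (fun t : ℝ => F (v + t • h)) ⟪F' (v + t • h), h⟫ t := by
      have h := (hdiff (v + t • h)).comp_hasDerivAt t h1
      exact h
    have h3 := (h2.sub ((hasDerivAt_id t).mul_const ⟪F' v, h⟫)).sub
      (((hasDerivAt_id t).pow 2).const_mul (L / 2 * ‖h‖ ^ 2))
    refine h3.congr_deriv ?_
    simp
    ring
  have hanti := antitoneOn_of_deriv_nonpos (convex_Icc (0:ℝ) 1)
    (fun t _ => (hd t).continuousAt.continuousWithinAt)
    (fun t _ => (hd t).differentiableAt.differentiableWithinAt)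
    (by
      intro t ht
      rw [interior_Icc] at ht
      rw [(hd t).deriv, ← inner_sub_left]
      have h1 := real_inner_le_norm (F' (v + t • h) - F' v) h
      have h2 := hlip (v + t • h) v
      rw [add_sub_cancel_left, norm_smul, Real.norm_of_nonneg ht.1.le] at h2
      have h3 := mul_le_mul_of_nonneg_right h2 (norm_nonneg h)
      nlinarith)
  have := hanti (Set.left_mem_Icc.2 zero_le_one) (Set.right_mem_Icc.2 zero_le_one) zero_le_one
  simp at this
  linarith

lemma aux_coco {E : Type*} [NormedAddCommGroup E] [InnerProductSpace ℝ E]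
    (F : E → ℝ) (F' : E → E) (lam L : ℝ)
    (hdiff : ∀ x : E, HasFDerivAt F (InnerProductSpace.toDualMap ℝ E (F' x) : E →L[ℝ] ℝ) x)
    (hsc : ∀ u v : E, F u ≥ F v + ⟪F' v, u - v⟫ + lam / 2 * ‖u - v‖ ^ 2)
    (hlip : ∀ u v : E, ‖F' u - F' v‖ ≤ L * ‖u - v‖) (x y : E) (t : ℝ) :
    F x + ⟪F' x, y - x⟫ + lam / 2 * ‖y - x‖ ^ 2
      + (t - (L - lam) / 2 * t ^ 2) * ‖F' y - F' x - lam • (y - x)‖ ^ 2 ≤ F y := by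
  obtain ⟨D, hD⟩ : ∃ D, D = F' y - F' x - lam • (y - x) := ⟨_, rfl⟩
  rw [← hD]
  have h1 := hsc (y + (-t) • D) x
  have h2 := aux_descent F F' L hdiff hlip y ((-t) • D)
  have e : y + (-t) • D - x = (y - x) + (-t) • D := by abel
  rw [e, norm_add_sq_real, inner_add_right] at h1
  simp only [norm_smul, mul_pow, Real.norm_eq_abs, sq_abs, inner_smul_right] at h1 h2
  have h3 : ‖D‖ ^ 2 = ⟪F' y, D⟫ - ⟪F' x, D⟫ - lam * ⟪y - x, D⟫ := by
    rw [← real_inner_self_eq_norm_sq]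
    nth_rw 1 [hD]
    rw [inner_sub_left, inner_sub_left, real_inner_smul_left]
  have h4 : t * ‖D‖ ^ 2 = t * (⟪F' y, D⟫ - ⟪F' x, D⟫ - lam * ⟪y - x, D⟫) := by rw [h3]
  linarith

/-- contraction of the gradient descent update with step size
`η ≤ 2/(λ+L)`, from the proof of Theorem 2. -/
theorem stmt_8 {E : Type*} [NormedAddCommGroup E] [InnerProductSpace ℝ E]
    (F : E → ℝ) (F' : E → E) (lam L : ℝ) (hlam : 0 < lam) (hL : 0 < L)
    (hdiff : ∀ x : E, HasFDerivAt F (InnerProductSpace.toDualMap ℝ E (F' x) : E →L[ℝ] ℝ) x)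
    (hsc : ∀ u v : E, F u ≥ F v + ⟪F' v, u - v⟫ + lam / 2 * ‖u - v‖ ^ 2)
    (hlip : ∀ u v : E, ‖F' u - F' v‖ ≤ L * ‖u - v‖)
    (wstar : E) (hstar : F' wstar = 0) :
    ∀ (w : E) (η : ℝ), 0 ≤ η → η ≤ 2 / (lam + L) →
      ‖w - η • F' w - wstar‖ ≤ (1 - η * lam * L / (lam + L)) * ‖w - wstar‖ := by
  intro w η h0 hη
  by_cases hw : w = wstar
  · subst hw; simp [hstar]
  have hS : 0 < lam + L := by positivity
  have hdpos : 0 < ‖w - wstar‖ := norm_pos_iff.2 (sub_ne_zero.2 hw)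
  have e1 := fun t => aux_coco F F' lam L hdiff hsc hlip wstar w t
  have e2 := fun t => aux_coco F F' lam L hdiff hsc hlip w wstar t
  have hg := hlip w wstar
  have en : wstar - w = -(w - wstar) := by abel
  simp only [hstar, en, sub_zero, zero_sub, inner_zero_left, norm_neg, inner_neg_right,
    smul_neg, sub_neg_eq_add] at e1 e2 hg
  have eq : w - η • F' w - wstar = (w - wstar) - η • F' w := by abel
  rw [eq]
  generalize w - wstar = d at *
  generalize F' w = g at *
  have hn : ‖-g + lam • d‖ = ‖g - lam • d‖ := by
    rw [← norm_neg]; congr 1; abel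
  have hD : ‖g - lam • d‖ ^ 2 = ‖g‖ ^ 2 - 2 * lam * ⟪g, d⟫ + lam ^ 2 * ‖d‖ ^ 2 := by
    rw [norm_sub_sq_real, inner_smul_right, norm_smul, mul_pow, Real.norm_eq_abs, sq_abs]; ring
  simp only [hn] at e2
  have hmono : lam * ‖d‖ ^ 2 ≤ ⟪g, d⟫ := by
    have := e1 0; have := e2 0; simp at *; linarith
  have hcs := real_inner_le_norm g d
  have hlL : lam ≤ L := by
    by_contra hc
    push Not at hc
    nlinarith [mul_le_mul_of_nonneg_right hg hdpos.le, mul_pos hdpos hdpos]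
  have key : ‖g‖ ^ 2 + lam * L * ‖d‖ ^ 2 ≤ (lam + L) * ⟪g, d⟫ := by
    rcases hlL.eq_or_lt with h | h
    · subst h
      have : ‖g‖ ^ 2 ≤ (lam * ‖d‖) ^ 2 := by gcongr
      nlinarith
    · have hM : 0 < L - lam := by linarith
      have a := e1 (1 / (L - lam))
      have b := e2 (1 / (L - lam))
      have hc : 1 / (L - lam) - (L - lam) / 2 * (1 / (L - lam)) ^ 2 = 1 / (2 * (L - lam)) := by
        field_simp; ring
      rw [hc] at a b
      have c : (1 / (L - lam)) * ‖g - lam • d‖ ^ 2 ≤ ⟪g, d⟫ - lam * ‖d‖ ^ 2 := by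
        have : 1 / (L - lam) = 2 * (1 / (2 * (L - lam))) := by field_simp
        rw [this]; linarith
      rw [one_div_mul_eq_div, div_le_iff₀ hM, hD] at c
      nlinarith
  obtain ⟨x, hx⟩ : ∃ x, x = η / (lam + L) := ⟨_, rfl⟩
  have hηx : η = x * (lam + L) := by rw [hx]; field_simp
  have hx0 : 0 ≤ x := by rw [hx]; positivity
  have hη2 : x * (lam + L) ^ 2 ≤ 2 := by
    rw [le_div_iff₀ hS, hηx] at hη; linarith
  have ex : η * lam * L / (lam + L) = x * lam * L := by rw [hx]; ring
  rw [ex]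
  have hx1 : 0 ≤ 1 - x * lam * L := by
    nlinarith [mul_nonneg hx0 (sq_nonneg (lam - L))]
  refine abs_le_of_sq_le_sq' ?_ (mul_nonneg hx1 hdpos.le) |>.2
  rw [norm_sub_sq_real, inner_smul_right, norm_smul, mul_pow, Real.norm_eq_abs, sq_abs,
    real_inner_comm, hηx]
  have k1 := mul_le_mul_of_nonneg_left key hx0
  have k2 : 0 ≤ x * (2 - x * (lam + L) ^ 2) * ‖g‖ ^ 2 :=
    mul_nonneg (mul_nonneg hx0 (by linarith)) (sq_nonneg _)
  have k3 : 0 ≤ (x * lam * L * ‖d‖) ^ 2 := sq_nonneg _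
  linarith
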